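/- With G, d, T, gᵢ and the notion of 3-word as in the context, the 𝔽₃-subspace of G spanned by all 3-words in which each of the letters g₀, g₁, g₂, g₃, g₄, g₅ occurs exactly once and the letter g₆ occurs exactly three times has 𝔽₃-dimension 1. -/

import Mathlib

/-- The Grassmann (exterior) algebra over `𝔽₃` of the free module with basis
indexed by `ℕ × ℕ`. -/
abbrev Gr : Type := ExteriorAlgebra (ZMod 3) ((ℕ × ℕ) →₀ ZMod 3)

/-- The generator `i^{(j)}` of the Grassmann algebra, i.e. `ι(e_{i,j})`. -/
noncomputable abbrev gen (i j : ℕ) : Gr :=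
  ExteriorAlgebra.ι (ZMod 3) (Finsupp.single (i, j) (1 : ZMod 3))

/-- `gᵢ = ι(e_{i,0})`. -/
noncomputable abbrev g (i : ℕ) : Gr := gen i 0

/-- `IsWord3 g T x L` : `x` is a 3-word, for the ternary operation `T`, in the
multiset of letters `L` (a multiset of indices of the generators `g`). Each
`g i` is a 3-word in the singleton multiset `{i}`, and if `u, v, w` are 3-words
in `L₁, L₂, L₃` then `T u v w` is a 3-word in `L₁ + L₂ + L₃`. -/
inductive IsWord3 {G : Type*} (g : ℕ → G) (T : G → G → G → G) : G → Multiset ℕ → Prop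
  | letter (i : ℕ) : IsWord3 g T (g i) {i}
  | node {u v w : G} {L₁ L₂ L₃ : Multiset ℕ} :
      IsWord3 g T u L₁ → IsWord3 g T v L₂ → IsWord3 g T w L₃ →
      IsWord3 g T (T u v w) (L₁ + L₂ + L₃)

/-- The product of the generators indexed by a list. -/
noncomputable def monomial (l : List (ℕ × ℕ)) : Gr := (l.map fun p => gen p.1 p.2).prod

@[simp] lemma monomial_nil : monomial [] = 1 := rfl

@[simp] lemma monomial_cons (p : ℕ × ℕ) (l : List (ℕ × ℕ)) :
    monomial (p :: l) = gen p.1 p.2 * monomial l := by simp [monomial]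

lemma monomial_append (l l' : List (ℕ × ℕ)) :
    monomial (l ++ l') = monomial l * monomial l' := by simp [monomial]

lemma gen_mul_self (i j : ℕ) : gen i j * gen i j = 0 := ExteriorAlgebra.ι_sq_zero _

lemma gen_mul_gen_swap (i j k l : ℕ) : gen i j * gen k l = -(gen k l * gen i j) :=
  eq_neg_of_add_eq_zero_left (ExteriorAlgebra.ι_add_mul_swap _ _)

lemma monomial_perm {l l' : List (ℕ × ℕ)} (h : l.Perm l') :
    monomial l = monomial l' ∨ monomial l = -monomial l' := by
  induction h with
  | nil => simp
  | cons p _ ih => rcases ih with h | h <;> simp [h]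
  | swap p q l =>
    right
    simp only [monomial_cons, ← mul_assoc]
    rw [gen_mul_gen_swap, neg_mul]
  | trans _ _ ih₁ ih₂ => rcases ih₁ with h | h <;> rcases ih₂ with hres | hres <;> simp [h, hres]

lemma monomial_eq_zero_of_not_nodup {l : List (ℕ × ℕ)} (h : ¬ l.Nodup) : monomial l = 0 := by
  induction l with
  | nil => simp at h
  | cons p l ih =>
    by_cases hl : l.Nodup
    · have hp : p ∈ l := by simpa [hl] using h
      rcases monomial_perm (List.perm_cons_erase hp) with hres | hres <;>
        simp [hres, ← mul_assoc]
    · simp [ih hl]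

/-- Contraction against the coordinate functional of `p` annihilates monomials avoiding `p`. -/
lemma contractLeft_monomial {p : ℕ × ℕ} {l : List (ℕ × ℕ)} (hp : p ∉ l) :
    CliffordAlgebra.contractLeft (Q := (0 : QuadraticForm (ZMod 3) ((ℕ × ℕ) →₀ ZMod 3)))
      (Finsupp.lapply p) (monomial l) = 0 := by
  induction l with
  | nil => exact CliffordAlgebra.contractLeft_one _ _
  | cons q l ih =>
    rw [List.mem_cons, not_or] at hp
    rw [monomial_cons]
    refine (CliffordAlgebra.contractLeft_ι_mul _ _ _).trans ?_
    rw [ih hp.2]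
    simp [Ne.symm hp.1]

lemma monomial_ne_zero {l : List (ℕ × ℕ)} (h : l.Nodup) : monomial l ≠ 0 := by
  induction l with
  | nil => simp
  | cons p l ih =>
    rw [List.nodup_cons] at h
    intro h0
    apply ih h.2
    have key : CliffordAlgebra.contractLeft
        (Q := (0 : QuadraticForm (ZMod 3) ((ℕ × ℕ) →₀ ZMod 3)))
        (Finsupp.lapply p) (monomial (p :: l)) = monomial l := by
      rw [monomial_cons]
      refine (CliffordAlgebra.contractLeft_ι_mul _ _ _).trans ?_
      rw [contractLeft_monomial h.1]
      simp
    rw [← key, h0, map_zero]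

/-- The span of the monomials with letters `L` (forgetting orders of differentiation) and
total order of differentiation `n`. -/
noncomputable def homogeneous (L : Multiset ℕ) (n : ℕ) : Submodule (ZMod 3) Gr :=
  Submodule.span (ZMod 3)
    (monomial '' {l | ((l.map Prod.fst : List ℕ) : Multiset ℕ) = L ∧ (l.map Prod.snd).sum = n})

lemma monomial_mem_homogeneous (l : List (ℕ × ℕ)) :
    monomial l ∈ homogeneous (l.map Prod.fst : List ℕ) (l.map Prod.snd).sum :=
  Submodule.subset_span ⟨l, ⟨rfl, rfl⟩, rfl⟩

lemma mul_mem_homogeneous {L L' : Multiset ℕ} {n n' : ℕ} {x y : Gr}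
    (hx : x ∈ homogeneous L n) (hy : y ∈ homogeneous L' n') :
    x * y ∈ homogeneous (L + L') (n + n') := by
  have h := Submodule.mul_mem_mul hx hy
  rw [homogeneous, homogeneous, Submodule.span_mul_span] at h
  refine Submodule.span_mono ?_ h
  rintro _ ⟨_, ⟨l, ⟨rfl, rfl⟩, rfl⟩, _, ⟨l', ⟨rfl, rfl⟩, rfl⟩, rfl⟩
  exact ⟨l ++ l', by simp, monomial_append l l'⟩

section Derivation

variable {d : Gr →ₗ[ZMod 3] Gr} (hLeib : ∀ u v : Gr, d (u * v) = d u * v + u * d v)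
  (hd : ∀ i j : ℕ, d (gen i j) = gen i (j + 1))

include hLeib in
lemma map_one_eq_zero_of_leibniz : d 1 = 0 := by
  simpa using hLeib 1 1

include hLeib hd

lemma map_monomial_mem_homogeneous (l : List (ℕ × ℕ)) :
    d (monomial l) ∈ homogeneous (l.map Prod.fst : List ℕ) ((l.map Prod.snd).sum + 1) := by
  induction l with
  | nil => simp [map_one_eq_zero_of_leibniz hLeib]
  | cons p l ih =>
    rw [monomial_cons, hLeib, hd]
    refine add_mem ?_ ?_
    · have h := monomial_mem_homogeneous ((p.1, p.2 + 1) :: l)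
      simpa [add_right_comm] using h
    · have h := mul_mem_homogeneous (monomial_mem_homogeneous [p]) ih
      simpa [add_assoc] using h

lemma map_mem_homogeneous {L : Multiset ℕ} {n : ℕ} {x : Gr} (hx : x ∈ homogeneous L n) :
    d x ∈ homogeneous L (n + 1) := by
  suffices h : homogeneous L n ≤ (homogeneous L (n + 1)).comap d from h hx
  refine Submodule.span_le.2 ?_
  rintro _ ⟨l, ⟨rfl, rfl⟩, rfl⟩
  exact map_monomial_mem_homogeneous hLeib hd l

/-- A 3-word with `2n + 1` letters is homogeneous of differential order `n`. -/
lemma IsWord3.mem_homogeneous {x : Gr} {L : Multiset ℕ}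
    (h : IsWord3 g (fun a b c => -d (a * b * c)) x L) :
    ∃ n, L.card = 2 * n + 1 ∧ x ∈ homogeneous L n := by
  induction h with
  | letter i => exact ⟨0, by simp, by simpa using monomial_mem_homogeneous [(i, 0)]⟩
  | node _ _ _ ihu ihv ihw =>
    obtain ⟨a, ha, hu⟩ := ihu
    obtain ⟨b, hb, hv⟩ := ihv
    obtain ⟨c, hc, hw⟩ := ihw
    refine ⟨a + b + c + 1, by simp only [Multiset.card_add]; omega, neg_mem ?_⟩
    exact map_mem_homogeneous hLeib hd (mul_mem_homogeneous (mul_mem_homogeneous hu hv) hw)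

end Derivation

/-- The index list of the product of all the letters in which the three copies of the last one
are differentiated zero, one and two times. -/
def lowest : List (ℕ × ℕ) :=
  [(0, 0), (1, 0), (2, 0), (3, 0), (4, 0), (5, 0), (6, 0), (6, 1), (6, 2)]

lemma exists_eq_cons_of_map_fst_eq_cons {s : Multiset (ℕ × ℕ)} {i : ℕ} {t : Multiset ℕ}
    (h : s.map Prod.fst = i ::ₘ t) :
    ∃ j s', s = (i, j) ::ₘ s' ∧ s'.map Prod.fst = t := by
  obtain ⟨⟨_, j⟩, hp, rfl, hres⟩ := (Multiset.map_eq_cons _ _ _ _).2 h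
  exact ⟨j, s.erase _, (Multiset.cons_erase hp).symm, hres⟩

lemma perm_lowest {l : List (ℕ × ℕ)} (hl : l.Nodup)
    (hfst : ((l.map Prod.fst : List ℕ) : Multiset ℕ) = {0, 1, 2, 3, 4, 5, 6, 6, 6})
    (hsnd : (l.map Prod.snd).sum = 3) : l.Perm lowest := by
  have hm : Multiset.map Prod.fst (l : Multiset (ℕ × ℕ)) = {0, 1, 2, 3, 4, 5, 6, 6, 6} := hfst
  have hs : (Multiset.map Prod.snd (l : Multiset (ℕ × ℕ))).sum = 3 := by simpa using hsnd
  have hn : (l : Multiset (ℕ × ℕ)).Nodup := hl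
  rw [← Multiset.coe_eq_coe]
  generalize (l : Multiset (ℕ × ℕ)) = s at hm hs hn ⊢
  obtain ⟨j₀, s, rfl, hm₀⟩ := exists_eq_cons_of_map_fst_eq_cons hm
  obtain ⟨j₁, s, rfl, hm₁⟩ := exists_eq_cons_of_map_fst_eq_cons hm₀
  obtain ⟨j₂, s, rfl, hm₂⟩ := exists_eq_cons_of_map_fst_eq_cons hm₁
  obtain ⟨j₃, s, rfl, hm₃⟩ := exists_eq_cons_of_map_fst_eq_cons hm₂
  obtain ⟨j₄, s, rfl, hm₄⟩ := exists_eq_cons_of_map_fst_eq_cons hm₃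
  obtain ⟨j₅, s, rfl, hm₅⟩ := exists_eq_cons_of_map_fst_eq_cons hm₄
  obtain ⟨a, s, rfl, hm₆⟩ := exists_eq_cons_of_map_fst_eq_cons hm₅
  obtain ⟨b, s, rfl, hm₇⟩ := exists_eq_cons_of_map_fst_eq_cons hm₆
  obtain ⟨⟨_, c⟩, rfl, rfl⟩ := Multiset.map_eq_singleton.1 hm₇
  simp at hs hn
  obtain ⟨rfl, rfl, rfl, rfl, rfl, rfl, habc⟩ :
      j₀ = 0 ∧ j₁ = 0 ∧ j₂ = 0 ∧ j₃ = 0 ∧ j₄ = 0 ∧ j₅ = 0 ∧ a + b + c = 3 := by omega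
  have ha : a ≤ 2 := by omega
  have hb : b ≤ 2 := by omega
  obtain rfl : c = 3 - a - b := by omega
  interval_cases a <;> interval_cases b <;> first | omega | decide

lemma homogeneous_le_span_lowest :
    homogeneous {0, 1, 2, 3, 4, 5, 6, 6, 6} 3 ≤ Submodule.span (ZMod 3) {monomial lowest} := by
  refine Submodule.span_le.2 ?_
  rintro _ ⟨l, ⟨hfst, hsnd⟩, rfl⟩
  by_cases hl : l.Nodup
  · have hmem := Submodule.mem_span_singleton_self (R := ZMod 3) (monomial lowest)
    rcases monomial_perm (perm_lowest hl hfst hsnd) with h | h <;> rw [h]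
    exacts [hmem, neg_mem hmem]
  · rw [monomial_eq_zero_of_not_nodup hl]
    exact zero_mem _

/-- The algebra endomorphism sending the generators outside `S` to zero and fixing the others. -/
noncomputable def restrict (S : Finset (ℕ × ℕ)) : Gr →ₐ[ZMod 3] Gr :=
  ExteriorAlgebra.map (Finsupp.linearCombination (ZMod 3)
    fun p => if p ∈ S then Finsupp.single p (1 : ZMod 3) else 0)

lemma restrict_gen (S : Finset (ℕ × ℕ)) (i j : ℕ) :
    restrict S (gen i j) = if (i, j) ∈ S then gen i j else 0 := by
  rw [restrict, gen, ExteriorAlgebra.map_apply_ι, Finsupp.linearCombination_single]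
  split_ifs <;> simp

section Derivation

variable {d : Gr →ₗ[ZMod 3] Gr} (hLeib : ∀ u v : Gr, d (u * v) = d u * v + u * d v)
  (hd : ∀ i j : ℕ, d (gen i j) = gen i (j + 1))
include hLeib hd

/-- The product of three words which together have these letters is a multiple of the lowest
monomial. -/
lemma mul_mem_span_lowest {u v w : Gr} {L₁ L₂ L₃ : Multiset ℕ}
    (hu : IsWord3 g (fun a b c => -d (a * b * c)) u L₁)
    (hv : IsWord3 g (fun a b c => -d (a * b * c)) v L₂)
    (hw : IsWord3 g (fun a b c => -d (a * b * c)) w L₃)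
    (hL : L₁ + L₂ + L₃ = {0, 1, 2, 3, 4, 5, 6, 6, 6}) :
    u * v * w ∈ Submodule.span (ZMod 3) {monomial lowest} := by
  obtain ⟨a, ha, hu⟩ := hu.mem_homogeneous hLeib hd
  obtain ⟨b, hb, hv⟩ := hv.mem_homogeneous hLeib hd
  obtain ⟨c, hc, hw⟩ := hw.mem_homogeneous hLeib hd
  have hcard := congrArg Multiset.card hL
  simp [ha, hb, hc] at hcard
  have h := mul_mem_homogeneous (mul_mem_homogeneous hu hv) hw
  rw [hL, show a + b + c = 3 by omega] at h
  exact homogeneous_le_span_lowest h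

lemma map_lowest_ne_zero : d (monomial lowest) ≠ 0 := by
  intro h
  have hres := congrArg (restrict
    {(0, 0), (1, 0), (2, 0), (3, 0), (4, 0), (5, 0), (6, 0), (6, 1), (6, 3)}) h
  refine monomial_ne_zero (l := [(0, 0), (1, 0), (2, 0), (3, 0), (4, 0), (5, 0), (6, 0), (6, 1),
    (6, 3)]) (by decide) ?_
  simpa [lowest, hLeib, hd, restrict_gen, -ExteriorAlgebra.ι_eq_zero_iff] using hres

/-- Words in these letters are multiples of the derivative of the lowest monomial. -/
lemma IsWord3.mem_span_map_lowest {x : Gr} (h : IsWord3 g (fun a b c => -d (a * b * c)) x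
    {0, 1, 2, 3, 4, 5, 6, 6, 6}) : x ∈ Submodule.span (ZMod 3) {d (monomial lowest)} := by
  generalize hL : ({0, 1, 2, 3, 4, 5, 6, 6, 6} : Multiset ℕ) = L at h
  cases h with
  | letter i => simpa using congrArg Multiset.card hL
  | node hu hv hw =>
    refine neg_mem ?_
    rw [← Set.image_singleton, Submodule.span_image]
    exact Submodule.mem_map_of_mem (mul_mem_span_lowest hLeib hd hu hv hw hL.symm)

lemma exists_word_ne_zero :
    ∃ u v w : Gr, u * v * w ≠ 0 ∧ u * v * w ∈ Submodule.span (ZMod 3) {monomial lowest} ∧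
      IsWord3 g (fun a b c => -d (a * b * c)) (-d (u * v * w)) {0, 1, 2, 3, 4, 5, 6, 6, 6} := by
  let T : Gr → Gr → Gr → Gr := fun a b c => -d (a * b * c)
  have hu := IsWord3.node (T := T) (.node (.node (.letter (g := g) 0) (.letter 1)
    (.letter 6)) (.letter 6) (.letter 2)) (.letter 3) (.letter 4)
  have hL : ({0} + {1} + {6} + {6} + {2} + {3} + {4} + {6} + {5} : Multiset ℕ) =
    {0, 1, 2, 3, 4, 5, 6, 6, 6} := by decide
  refine ⟨T (T (T (g 0) (g 1) (g 6)) (g 6) (g 2)) (g 3) (g 4), g 6, g 5, ?_,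
    mul_mem_span_lowest hLeib hd hu (.letter 6) (.letter 5) hL,
    hL ▸ IsWord3.node hu (.letter 6) (.letter 5)⟩
  intro h
  have hres := congrArg (restrict lowest.toFinset) h
  refine monomial_ne_zero (l := [(0, 0), (1, 0), (6, 2), (6, 1), (2, 0), (3, 0), (4, 0), (6, 0),
    (5, 0)]) (by decide) ?_
  simp only [T, lowest, hLeib, hd, restrict_gen, map_neg, map_add, map_mul, map_zero,
    List.mem_toFinset] at hres
  simp only [List.mem_cons, Prod.mk.injEq, List.not_mem_nil] at hres
  norm_num [-ExteriorAlgebra.ι_eq_zero_iff] at hres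
  simpa only [mul_assoc _ (gen 6 1) (gen 6 2), gen_mul_gen_swap 6 1 6 2, mul_neg, neg_neg,
    ← mul_assoc, neg_add_cancel, add_zero, neg_mul, neg_eq_zero, monomial_cons, monomial_nil,
    mul_one] using hres

end Derivation

/-- the `𝔽₃`-span of all 3-words in the letters g₀,…,g₅ (once each) and g₆ (three times)
has dimension `1`. -/
theorem stmt_11 (d : Gr →ₗ[ZMod 3] Gr)
    (hLeib : ∀ u v : Gr, d (u * v) = d u * v + u * d v)
    (hd : ∀ i j : ℕ, d (gen i j) = gen i (j + 1)) :
    Module.finrank (ZMod 3)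
      ↥(Submodule.span (ZMod 3)
        {x : Gr | IsWord3 g (fun a b c => -d (a * b * c)) x (({0, 1, 2, 3, 4, 5, 6, 6, 6} : Multiset ℕ))}) = 1 := by
  have eq : Submodule.span (ZMod 3) {x : Gr | IsWord3 g (fun a b c => -d (a * b * c)) x
      {0, 1, 2, 3, 4, 5, 6, 6, 6}} = Submodule.span (ZMod 3) {d (monomial lowest)} := by
    apply le_antisymm
    · refine Submodule.span_le.2 fun x hx => ?_
      exact hx.mem_span_map_lowest hLeib hd
    · obtain ⟨u, v, w, hne, hmem, hw⟩ := exists_word_ne_zero hLeib hd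
      obtain ⟨c, hc⟩ := Submodule.mem_span_singleton.1 hmem
      have hc0 : c ≠ 0 := by
        rintro rfl
        exact hne (by rw [← hc, zero_smul])
      rw [Submodule.span_singleton_le_iff_mem]
      have hx : d (monomial lowest) = (-c⁻¹) • -d (u * v * w) := by
        rw [← hc, map_smul, smul_neg, neg_smul, neg_neg, inv_smul_smul₀ hc0]
      rw [hx]
      exact Submodule.smul_mem _ _ (Submodule.subset_span hw)
  rw [eq]
  exact finrank_span_singleton (map_lowest_ne_zero hLeib hd)
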